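/- arXiv:1401.6206 — 5 statements merged into one kernel-verified Lean document; each statement's English description precedes it below -/
import Mathlib

section
/- Let k be a positive integer and let G be a finite simple graph with minimum degree δ. Then the k-forcing number satisfies F_k(G) ≥ δ - k + 1. -/
open Finset SimpleGraph

/-- One round of the `k`-forcing color change rule: to the currently colored set `C` we add
every vertex `w` having a colored neighbor `v` with at most `k` non-colored neighbors. -/
def kForceStep {V : Type*} [Fintype V] [DecidableEq V] (G : SimpleGraph V)
    [DecidableRel G.Adj] (k : ℕ) (C : Finset V) : Finset V :=
  C ∪ Finset.univ.filter (fun w =>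
    ∃ v ∈ C, G.Adj v w ∧ ((G.neighborFinset v) \ C).card ≤ k)

/-- `S` is a `k`-forcing set: iterating the color change rule starting from `S`
eventually colors all vertices. -/
def IsKForcingSet {V : Type*} [Fintype V] [DecidableEq V] (G : SimpleGraph V)
    [DecidableRel G.Adj] (k : ℕ) (S : Finset V) : Prop :=
  (kForceStep G k)^[Fintype.card V] S = Finset.univ

/-- The `k`-forcing number: the minimum cardinality of a `k`-forcing set. -/
noncomputable def kForcingNumber {V : Type*} [Fintype V] [DecidableEq V] (G : SimpleGraph V)
    [DecidableRel G.Adj] (k : ℕ) : ℕ :=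
  sInf {m | ∃ S : Finset V, IsKForcingSet G k S ∧ S.card = m}

theorem isKForcingSet_univ {V : Type*} [Fintype V] [DecidableEq V] (G : SimpleGraph V)
    [DecidableRel G.Adj] (k : ℕ) : IsKForcingSet G k Finset.univ :=
  Function.iterate_fixed (by simp [kForceStep]) _

theorem IsKForcingSet.exists_card_neighborFinset_sdiff_le {V : Type*} [Fintype V] [DecidableEq V]
    {G : SimpleGraph V} [DecidableRel G.Adj] {k : ℕ} {S : Finset V} (hS : IsKForcingSet G k S)
    (hne : S ≠ Finset.univ) : ∃ v ∈ S, ((G.neighborFinset v) \ S).card ≤ k := by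
  by_contra! h
  have hfix : kForceStep G k S = S := by
    refine Finset.union_eq_left.2 fun w hw => ?_
    obtain ⟨v, hv, -, hle⟩ := (Finset.mem_filter.1 hw).2
    exact absurd hle (h v hv).not_ge
  exact hne ((Function.iterate_fixed hfix _).symm.trans hS)

theorem IsKForcingSet.exists_mem_card_neighborFinset_sdiff_le {V : Type*} [Fintype V]
    [DecidableEq V] [Nonempty V] {G : SimpleGraph V} [DecidableRel G.Adj] {k : ℕ} {S : Finset V}
    (hS : IsKForcingSet G k S) : ∃ v ∈ S, ((G.neighborFinset v) \ S).card ≤ k := by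
  by_cases hne : S = Finset.univ
  · exact ⟨Classical.arbitrary V, by simp [hne],
      by simp [hne, Finset.sdiff_eq_empty_iff_subset.2 (Finset.subset_univ _)]⟩
  · exact hS.exists_card_neighborFinset_sdiff_le hne

theorem IsKForcingSet.minDegree_sub_lt_card {V : Type*} [Fintype V] [DecidableEq V] [Nonempty V]
    {G : SimpleGraph V} [DecidableRel G.Adj] {k : ℕ} {S : Finset V}
    (hS : IsKForcingSet G k S) : G.minDegree - k < S.card := by
  obtain ⟨v, hv, hle⟩ := hS.exists_mem_card_neighborFinset_sdiff_le
  have hdeg : G.minDegree ≤ (G.neighborFinset v).card := G.minDegree_le_degree v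
  have hsplit := Finset.card_sdiff_add_card_inter (G.neighborFinset v) S
  have hlt : (G.neighborFinset v ∩ S).card < S.card :=
    Finset.card_lt_card ⟨Finset.inter_subset_right, fun h =>
      G.notMem_neighborFinset_self v (Finset.mem_inter.1 (h hv)).1⟩
  omega

/-- For a positive integer `k` and a graph `G` with minimum degree `δ`,
the `k`-forcing number satisfies `F_k(G) ≥ δ - k + 1`. -/
theorem kForcingNumber_ge_minDegree_sub {V : Type*} [Fintype V] [DecidableEq V] [Nonempty V]
    (G : SimpleGraph V) [DecidableRel G.Adj] (k : ℕ) (hk : 1 ≤ k) :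
    G.minDegree - k + 1 ≤ kForcingNumber G k := by
  obtain ⟨S, hS, hcard⟩ :=
    Nat.sInf_mem (s := {m | ∃ S : Finset V, IsKForcingSet G k S ∧ S.card = m})
      ⟨_, Finset.univ, isKForcingSet_univ G k, rfl⟩
  exact hS.minDegree_sub_lt_card.trans_eq hcard
end

section
/- Let G be a finite simple connected graph with maximum degree Δ ≥ 2. Then F_{Δ-1}(G) ≤ 2, with equality F_{Δ-1}(G) = 2 holding if and only if G is Δ-regular (every vertex has degree Δ). -/
open Finset SimpleGraph

lemma subset_kForceStep {V : Type*} [Fintype V] [DecidableEq V] (G : SimpleGraph V)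
    [DecidableRel G.Adj] (k : ℕ) (C : Finset V) : C ⊆ kForceStep G k C :=
  subset_union_left

/-- A vertex with a colored neighbor has at most `Δ - 1` non-colored neighbors. -/
lemma card_neighborFinset_sdiff_le_of_adj {V : Type*} [Fintype V] [DecidableEq V]
    (G : SimpleGraph V) [DecidableRel G.Adj] {C : Finset V} {v w : V} (hv : v ∈ C)
    (h : G.Adj w v) : (G.neighborFinset w \ C).card ≤ G.maxDegree - 1 := by
  have hlt : (G.neighborFinset w \ C).card < (G.neighborFinset w).card := by
    refine card_lt_card ⟨sdiff_subset, fun hsub => ?_⟩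
    have := hsub ((G.mem_neighborFinset w v).2 h)
    exact (mem_sdiff.1 this).2 hv
  have := G.degree_le_maxDegree w
  rw [card_neighborFinset_eq_degree] at hlt
  omega

/-- If every colored vertex has at most `Δ - 1` non-colored neighbors, this remains true after
a round of `(Δ - 1)`-forcing. -/
lemma card_sdiff_kForceStep_le {V : Type*} [Fintype V] [DecidableEq V]
    (G : SimpleGraph V) [DecidableRel G.Adj] {C : Finset V}
    (hC : ∀ v ∈ C, (G.neighborFinset v \ C).card ≤ G.maxDegree - 1) :
    ∀ v ∈ kForceStep G (G.maxDegree - 1) C,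
      (G.neighborFinset v \ kForceStep G (G.maxDegree - 1) C).card ≤ G.maxDegree - 1 := by
  intro w hw
  have hsub := subset_kForceStep G (G.maxDegree - 1) C
  rcases mem_union.1 hw with hw | hw
  · exact (card_le_card (sdiff_subset_sdiff le_rfl hsub)).trans (hC w hw)
  · obtain ⟨-, v, hv, hvw, -⟩ := mem_filter.1 hw
    exact card_neighborFinset_sdiff_le_of_adj G (hsub hv) hvw.symm

/-- If every colored vertex can force in a connected graph, a round of forcing colors a new
vertex unless all vertices are colored. -/
lemma card_lt_card_kForceStep {V : Type*} [Fintype V] [DecidableEq V]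
    (G : SimpleGraph V) [DecidableRel G.Adj] (hconn : G.Connected) {k : ℕ} {C : Finset V}
    (hne : C.Nonempty) (hC : ∀ v ∈ C, (G.neighborFinset v \ C).card ≤ k)
    (huniv : C ≠ univ) : C.card < (kForceStep G k C).card := by
  obtain ⟨a, ha⟩ := hne
  obtain ⟨b, hb⟩ : ∃ b, b ∉ C := by
    by_contra! h
    exact huniv (eq_univ_iff_forall.2 h)
  obtain ⟨p⟩ := hconn.preconnected a b
  obtain ⟨d, -, hd₁, hd₂⟩ := p.exists_boundary_dart (C : Set V) ha hb
  refine card_lt_card ⟨subset_kForceStep G k C, fun hsub => hd₂ (hsub ?_)⟩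
  exact mem_union_right _ (mem_filter.2 ⟨mem_univ _, d.fst, hd₁, d.adj, hC _ hd₁⟩)

/-- In a connected graph, a nonempty set all of whose vertices have at most `Δ - 1` neighbors
outside of it is `(Δ - 1)`-forcing. -/
lemma isKForcingSet_of_card_sdiff_le {V : Type*} [Fintype V] [DecidableEq V]
    (G : SimpleGraph V) [DecidableRel G.Adj] (hconn : G.Connected) {S : Finset V}
    (hne : S.Nonempty) (hS : ∀ v ∈ S, (G.neighborFinset v \ S).card ≤ G.maxDegree - 1) :
    IsKForcingSet G (G.maxDegree - 1) S := by
  have key : ∀ n, ∃ C, (kForceStep G (G.maxDegree - 1))^[n] S = C ∧ C.Nonempty ∧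
      (∀ v ∈ C, (G.neighborFinset v \ C).card ≤ G.maxDegree - 1) ∧
      (C = univ ∨ n ≤ C.card) := by
    intro n
    induction n with
    | zero => exact ⟨S, rfl, hne, hS, Or.inr (Nat.zero_le _)⟩
    | succ n ih =>
      obtain ⟨C, hCeq, hCne, hC, hcard⟩ := ih
      have hsub := subset_kForceStep G (G.maxDegree - 1) C
      refine ⟨kForceStep G (G.maxDegree - 1) C, ?_, hCne.mono hsub,
        card_sdiff_kForceStep_le G hC, ?_⟩
      · rw [Function.iterate_succ_apply', hCeq]
      · by_cases hu : C = univ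
        · left
          rw [hu] at hsub ⊢
          exact univ_subset_iff.1 hsub
        · right
          have := card_lt_card_kForceStep G hconn hCne hC hu
          have := hcard.resolve_left hu
          omega
  obtain ⟨C, hCeq, -, -, hC⟩ := key (Fintype.card V)
  rw [IsKForcingSet, hCeq]
  exact hC.elim id fun h => (card_eq_iff_eq_univ C).1 (le_antisymm (card_le_univ C) h)

/-- A set that is stable under forcing is forcing only if it contains all vertices. -/
lemma IsKForcingSet.eq_univ_of_kForceStep_eq {V : Type*} [Fintype V] [DecidableEq V]
    {G : SimpleGraph V} [DecidableRel G.Adj] {k : ℕ} {S : Finset V}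
    (h : IsKForcingSet G k S) (hS : kForceStep G k S = S) : S = univ := by
  rwa [IsKForcingSet, Function.iterate_fixed hS] at h

lemma IsKForcingSet.kForcingNumber_le {V : Type*} [Fintype V] [DecidableEq V]
    {G : SimpleGraph V} [DecidableRel G.Adj] {k : ℕ} {S : Finset V}
    (h : IsKForcingSet G k S) : kForcingNumber G k ≤ S.card :=
  Nat.sInf_le ⟨S, h, rfl⟩

/-- If every vertex has degree larger than `k`, a `k`-forcing set of a graph with at least
two vertices has at least two elements. -/
lemma IsKForcingSet.two_le_card {V : Type*} [Fintype V] [DecidableEq V] [Nontrivial V]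
    {G : SimpleGraph V} [DecidableRel G.Adj] {k : ℕ} (hdeg : ∀ v, k < G.degree v)
    {S : Finset V} (h : IsKForcingSet G k S) : 2 ≤ S.card := by
  by_contra! hlt
  have hfix : kForceStep G k S = S := by
    refine union_eq_left.2 fun w hw => ?_
    obtain ⟨-, v, hv, -, hcard⟩ := mem_filter.1 hw
    have hdisj : Disjoint (G.neighborFinset v) S := by
      refine Finset.disjoint_left.2 fun x hx hxS => ?_
      have hxv : x = v := card_le_one.1 (by omega) x hxS v hv
      exact G.loopless.irrefl v (hxv ▸ (G.mem_neighborFinset v x).1 hx)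
    rw [sdiff_eq_self_of_disjoint hdisj, card_neighborFinset_eq_degree] at hcard
    exact absurd (hdeg v) (by omega)
  have := h.eq_univ_of_kForceStep_eq hfix
  have hV := Fintype.one_lt_card (α := V)
  rw [this, card_univ] at hlt
  omega

/-- If `G` is connected with maximum degree `Δ ≥ 2`, then `F_{Δ-1}(G) ≤ 2`,
with equality iff `G` is `Δ`-regular. -/
theorem kForcingNumber_maxDegree_pred {V : Type*} [Fintype V] [DecidableEq V]
    (G : SimpleGraph V) [DecidableRel G.Adj]
    (hconn : G.Connected) (hΔ : 2 ≤ G.maxDegree) :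
    kForcingNumber G (G.maxDegree - 1) ≤ 2 ∧
      (kForcingNumber G (G.maxDegree - 1) = 2 ↔ G.IsRegularOfDegree G.maxDegree) := by
  have : Nonempty V := hconn.nonempty
  obtain ⟨u, hu⟩ := G.exists_maximal_degree_vertex
  obtain ⟨w, huw⟩ := (G.degree_pos_iff_exists_adj u).1 (by omega)
  have : Nontrivial V := ⟨u, w, huw.ne⟩
  have hforcing : IsKForcingSet G (G.maxDegree - 1) {u, w} := by
    refine isKForcingSet_of_card_sdiff_le G hconn (insert_nonempty _ _) fun v hv => ?_
    rcases mem_insert.1 hv with rfl | hv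
    · exact card_neighborFinset_sdiff_le_of_adj G (by simp) huw
    · rw [mem_singleton.1 hv]
      exact card_neighborFinset_sdiff_le_of_adj G (by simp) huw.symm
  have hle : kForcingNumber G (G.maxDegree - 1) ≤ 2 := hforcing.kForcingNumber_le.trans card_le_two
  refine ⟨hle, fun heq v => ?_, fun hreg => le_antisymm hle ?_⟩
  · by_contra hv
    have hlt := lt_of_le_of_ne (G.degree_le_maxDegree v) hv
    have hsingle : IsKForcingSet G (G.maxDegree - 1) {v} := by
      refine isKForcingSet_of_card_sdiff_le G hconn (singleton_nonempty v) fun x hx => ?_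
      rw [mem_singleton.1 hx]
      refine (card_le_card sdiff_subset).trans ?_
      rw [card_neighborFinset_eq_degree]
      omega
    have := hsingle.kForcingNumber_le
    rw [heq, card_singleton] at this
    omega
  · refine le_csInf ⟨_, _, hforcing, rfl⟩ ?_
    rintro m ⟨S, hS, rfl⟩
    refine hS.two_le_card fun v => ?_
    rw [hreg v]
    omega
end

section
/- Let G be a connected finite simple graph with maximum degree Δ ≥ 2 and n vertices. Then n - γ_c(G) ≤ ((Δ - 2)·n + 2) / (Δ - 1); equivalently, the connected domination number satisfies γ_c(G) ≥ (n - 2) / (Δ - 1). -/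
open Finset SimpleGraph

/-- `G` is `k`-connected: it has more than `k` vertices and the removal of any set of fewer
than `k` vertices results in a connected (induced) subgraph. -/
def KConnected {V : Type*} [Fintype V] [DecidableEq V] (G : SimpleGraph V) (k : ℕ) : Prop :=
  k < Fintype.card V ∧
    ∀ A : Finset V, A.card < k → (G.induce ((A : Set V)ᶜ)).Connected

/-- `D` is a connected `k`-dominating set: every vertex not in `D` has at least `k` neighbors
in `D`, and the subgraph induced by `D` is connected. -/
def IsConnKDomSet {V : Type*} [Fintype V] [DecidableEq V] (G : SimpleGraph V)
    [DecidableRel G.Adj] (k : ℕ) (D : Finset V) : Prop :=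
  (∀ v : V, v ∉ D → k ≤ ((G.neighborFinset v) ∩ D).card) ∧
    (G.induce (D : Set V)).Connected

/-- The connected `k`-domination number: the minimum cardinality of a connected
`k`-dominating set. -/
noncomputable def connKDomNumber {V : Type*} [Fintype V] [DecidableEq V] (G : SimpleGraph V)
    [DecidableRel G.Adj] (k : ℕ) : ℕ :=
  sInf {m | ∃ D : Finset V, IsConnKDomSet G k D ∧ D.card = m}

/-- In a connected induced subgraph, the degrees sum to at least twice the order minus two. -/
lemma two_mul_card_le_sum_card_neighborFinset_inter {V : Type*} [Fintype V] [DecidableEq V]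
    (G : SimpleGraph V) [DecidableRel G.Adj] {D : Finset V}
    (hD : (G.induce (D : Set V)).Connected) :
    2 * D.card ≤ ∑ v ∈ D, (G.neighborFinset v ∩ D).card + 2 := by
  have hedge := hD.card_vert_le_card_edgeSet_add_one
  have hdeg : ∀ v : (D : Set V),
      (G.induce (D : Set V)).degree v = (G.neighborFinset v ∩ D).card := fun v => by
    have h := congrArg Finset.card (map_neighborFinset_induce (G := G) (s := (D : Set V)) v)
    rw [card_map, card_neighborFinset_eq_degree, Finset.toFinset_coe] at h
    convert h
  have hsum := (G.induce (D : Set V)).sum_degrees_eq_twice_card_edges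
  simp only [hdeg] at hsum
  have hcoe : ∑ v : (D : Set V), (G.neighborFinset v ∩ D).card =
      ∑ v ∈ D, (G.neighborFinset v ∩ D).card :=
    Finset.sum_coe_sort D fun v => (G.neighborFinset v ∩ D).card
  rw [Nat.card_eq_fintype_card, Nat.card_eq_fintype_card, ← edgeFinset_card] at hedge
  have hcard : Fintype.card (D : Set V) = D.card := by simp
  omega

/-- The vertices outside a dominating set are covered by the outside neighbors of its members. -/
lemma card_compl_le_sum_card_neighborFinset_sdiff {V : Type*} [Fintype V] [DecidableEq V]
    (G : SimpleGraph V) [DecidableRel G.Adj] {D : Finset V}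
    (hD : ∀ v ∉ D, 1 ≤ (G.neighborFinset v ∩ D).card) :
    Dᶜ.card ≤ ∑ v ∈ D, (G.neighborFinset v \ D).card := by
  refine (Finset.card_le_card fun w hw => ?_).trans Finset.card_biUnion_le
  rw [Finset.mem_compl] at hw
  obtain ⟨v, hv⟩ := Finset.card_pos.mp (hD w hw)
  simp only [Finset.mem_inter, mem_neighborFinset] at hv
  simp only [Finset.mem_biUnion, Finset.mem_sdiff, mem_neighborFinset]
  exact ⟨v, hv.2, hv.1.symm, hw⟩

lemma IsConnKDomSet.card_add_card_le {V : Type*} [Fintype V] [DecidableEq V]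
    {G : SimpleGraph V} [DecidableRel G.Adj] {D : Finset V} (hD : IsConnKDomSet G 1 D) :
    Fintype.card V + D.card ≤ D.card * G.maxDegree + 2 := by
  have hin := two_mul_card_le_sum_card_neighborFinset_inter G hD.2
  have hout := card_compl_le_sum_card_neighborFinset_sdiff G hD.1
  have hdeg : ∑ v ∈ D, (G.neighborFinset v \ D).card + ∑ v ∈ D, (G.neighborFinset v ∩ D).card
      ≤ D.card * G.maxDegree := by
    rw [← Finset.sum_add_distrib]
    refine Finset.sum_le_card_nsmul _ _ _ fun v _ => ?_
    rw [Finset.card_sdiff_add_card_inter, card_neighborFinset_eq_degree]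
    exact G.degree_le_maxDegree v
  have hcard := Finset.card_add_card_compl D
  omega

lemma exists_isConnKDomSet_card_eq {V : Type*} [Fintype V] [DecidableEq V]
    {G : SimpleGraph V} [DecidableRel G.Adj] (hconn : G.Connected) (k : ℕ) :
    ∃ D : Finset V, IsConnKDomSet G k D ∧ D.card = connKDomNumber G k := by
  refine Nat.sInf_mem (s := {m | ∃ D : Finset V, IsConnKDomSet G k D ∧ D.card = m})
    ⟨_, Finset.univ, ⟨fun v hv => absurd (Finset.mem_univ v) hv, ?_⟩, rfl⟩
  rw [Finset.coe_univ]
  exact (induceUnivIso G).connected_iff.mpr hconn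

/-- Theorem: If `G` is connected with maximum degree `Δ ≥ 2`, then
`n - γ_c(G) ≤ ((Δ - 2) n + 2) / (Δ - 1)`; equivalently `γ_c(G) ≥ (n - 2) / (Δ - 1)`. -/
theorem card_sub_connDom_le {V : Type*} [Fintype V] [DecidableEq V]
    (G : SimpleGraph V) [DecidableRel G.Adj]
    (hconn : G.Connected) (hΔ : 2 ≤ G.maxDegree) :
    ((Fintype.card V : ℝ) - connKDomNumber G 1) ≤
        (((G.maxDegree : ℝ) - 2) * (Fintype.card V) + 2) / ((G.maxDegree : ℝ) - 1) ∧
      ((Fintype.card V : ℝ) - 2) / ((G.maxDegree : ℝ) - 1) ≤ connKDomNumber G 1 := by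
  obtain ⟨D, hD, hcard⟩ := exists_isConnKDomSet_card_eq hconn 1
  have hbound : (Fintype.card V : ℝ) + connKDomNumber G 1 ≤
      connKDomNumber G 1 * G.maxDegree + 2 := by
    rw [← hcard]
    exact_mod_cast hD.card_add_card_le
  have hΔ' : (2 : ℝ) ≤ G.maxDegree := by exact_mod_cast hΔ
  have hpos : (0 : ℝ) < G.maxDegree - 1 := by linarith
  constructor
  · rw [le_div_iff₀ hpos]
    linarith
  · rw [div_le_iff₀ hpos]
    linarith
end

section
/- Let G be a Hamiltonian finite simple graph on n ≥ 4 vertices possessing a Hamiltonian cycle C with exactly t ≥ 1 chords (edges of G not lying on C). Then the zero forcing number satisfies Z(G) = F_1(G) ≤ t + 1. -/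
open Finset SimpleGraph

theorem kForcingNumber_le_card {V : Type*} [Fintype V] [DecidableEq V] {G : SimpleGraph V}
    [DecidableRel G.Adj] {k : ℕ} {S : Finset V} (hS : IsKForcingSet G k S) :
    kForcingNumber G k ≤ #S :=
  Nat.sInf_le ⟨S, hS, rfl⟩

/-- If the vertices are enumerated along a walk `f 0, f 1, …` such that `f 0 ∈ S` and every
neighbor of `f i` lies in `S` or among `f 0, …, f (i + 1)`, then `S` is zero forcing. -/
theorem isKForcingSet_one_of_enumeration {V : Type*} [Fintype V] [DecidableEq V]
    {G : SimpleGraph V} [DecidableRel G.Adj] {S : Finset V} (f : ℕ → V)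
    (hsurj : ∀ w, ∃ i < Fintype.card V, f i = w) (hzero : f 0 ∈ S)
    (hadj : ∀ i, i + 1 < Fintype.card V → G.Adj (f i) (f (i + 1)))
    (hnbr : ∀ i, i + 1 < Fintype.card V → ∀ y, G.Adj (f i) y → y ∈ S ∨ ∃ j ≤ i + 1, f j = y) :
    IsKForcingSet G 1 S := by
  have step (T : Finset V) : T ⊆ kForceStep G 1 T := Finset.subset_union_left
  have subset_iterate (m : ℕ) : S ⊆ (kForceStep G 1)^[m] S := by
    induction m with
    | zero => exact subset_rfl
    | succ m ih =>
      rw [Function.iterate_succ_apply']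
      exact ih.trans (step _)
  have colored (m : ℕ) : ∀ j ≤ m, j < Fintype.card V → f j ∈ (kForceStep G 1)^[m] S := by
    induction m with
    | zero =>
      intro j hj _
      obtain rfl : j = 0 := by lia
      exact hzero
    | succ m ih =>
      intro j hj hjn
      rw [Function.iterate_succ_apply']
      rcases hj.lt_or_eq with hj | rfl
      · exact step _ (ih j (by lia) hjn)
      refine Finset.mem_union_right _ (Finset.mem_filter.2 ⟨Finset.mem_univ _, f m,
        ih m le_rfl (by lia), hadj m hjn, ?_⟩)
      rw [← Finset.card_singleton (f (m + 1))]
      refine Finset.card_le_card fun y hy => ?_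
      rw [Finset.mem_sdiff, mem_neighborFinset] at hy
      rcases hnbr m hjn y hy.1 with h | ⟨i, hi, rfl⟩
      · exact absurd (subset_iterate m h) hy.2
      · rcases hi.lt_or_eq with hi | rfl
        · exact absurd (ih i (by lia) (by lia)) hy.2
        · exact Finset.mem_singleton_self _
  rw [IsKForcingSet, Finset.eq_univ_iff_forall]
  intro w
  obtain ⟨i, hi, rfl⟩ := hsurj w
  exact colored _ i hi.le hi

/-- The bound when the base point of the Hamiltonian cycle is an endpoint of a chord: the first
vertex after the base point together with the later endpoint of each chord is zero forcing. -/
theorem kForcingNumber_one_le_of_chord_at_base {V : Type*} [Fintype V] [DecidableEq V]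
    {G : SimpleGraph V} [DecidableRel G.Adj] {a b : V} {C : G.Walk a a}
    (hC : C.IsHamiltonianCycle) (hab : s(a, b) ∈ G.edgeFinset \ C.edges.toFinset) :
    kForcingNumber G 1 ≤ #(G.edgeFinset \ C.edges.toFinset) + 1 := by
  have hlen := hC.length_eq
  have hinj := hC.isCycle.getVert_injOn
  have hinj' {i j : ℕ} (hi : 1 ≤ i) (hi' : i ≤ C.length) (hj : 1 ≤ j) (hj' : j ≤ C.length)
      (h : C.getVert i = C.getVert j) : i = j := hinj ⟨hi, hi'⟩ ⟨hj, hj'⟩ h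
  have hpos : 3 ≤ C.length := hC.isCycle.three_le_length
  have hex (w : V) : ∃ i, (1 ≤ i ∧ i ≤ C.length) ∧ C.getVert i = w := by
    obtain ⟨i, rfl, hi⟩ := Walk.mem_support_iff_exists_getVert.1 (hC.mem_support w)
    rcases Nat.eq_zero_or_pos i with rfl | h
    · exact ⟨C.length, by lia, by simp⟩
    · exact ⟨i, ⟨h, hi⟩, rfl⟩
  choose idx hidx hvert using hex
  have hmax (e : Sym2 V) : ∃ y, ∃ x, e = s(x, y) ∧ idx x ≤ idx y := by
    induction e with
    | _ x y =>
      rcases le_total (idx x) (idx y) with h | h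
      · exact ⟨y, x, rfl, h⟩
      · exact ⟨x, y, Sym2.eq_swap, h⟩
  choose top bot hedge hle using hmax
  set E := G.edgeFinset \ C.edges.toFinset with hE
  have hidx_a : idx a = C.length :=
    hinj' (hidx a).1 (hidx a).2 (by lia) le_rfl (by rw [hvert, Walk.getVert_length])
  have htop {e : Sym2 V} (he : e ∈ E) : top e ∈ insert (C.getVert 1) (E.image top) :=
    Finset.mem_insert_of_mem (Finset.mem_image_of_mem _ he)
  have ha : a ∈ insert (C.getVert 1) (E.image top) := by
    have h := htop hab
    have h₁ := hle s(a, b)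
    rcases Sym2.eq_iff.1 (hedge s(a, b)) with ⟨h₂, -⟩ | ⟨h₂, -⟩
    · rw [← h₂, hidx_a] at h₁
      have h₃ := hvert (top s(a, b))
      rw [le_antisymm (hidx _).2 h₁, Walk.getVert_length] at h₃
      rwa [← h₃] at h
    · rwa [← h₂] at h
  refine (kForcingNumber_le_card (S := insert (C.getVert 1) (E.image top)) ?_).trans
    ((Finset.card_insert_le _ _).trans (Nat.add_le_add_right Finset.card_image_le 1))
  refine isKForcingSet_one_of_enumeration (fun i => C.getVert (i + 1)) (fun w => ?_)
    (Finset.mem_insert_self _ _) (fun i hi => C.adj_getVert_succ (by lia)) fun i hi y hy => ?_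
  · obtain ⟨h₁, h₂⟩ := hidx w
    exact ⟨idx w - 1, by lia, by rw [Nat.sub_add_cancel h₁, hvert]⟩
  by_cases hc : s(C.getVert (i + 1), y) ∈ C.edges
  · obtain ⟨k, hk, h⟩ := (C.mk_mem_edges_iff_exists).1 hc
    rcases Sym2.eq_iff.1 h with ⟨h₁, h₂⟩ | ⟨h₁, h₂⟩
    · rcases Nat.eq_zero_or_pos k with rfl | hk₀
      · rw [Walk.getVert_zero] at h₁
        have := hinj' (by lia) le_rfl (by lia) (by lia) (C.getVert_length.trans h₁)
        lia
      · obtain rfl := hinj' hk₀ hk.le (by lia) (by lia) h₁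
        exact .inr ⟨i + 1, le_rfl, h₂⟩
    · obtain rfl : k = i := by
        have := hinj' (by lia) hk (by lia) (by lia) h₂
        lia
      rcases Nat.eq_zero_or_pos k with rfl | hk₀
      · rw [Walk.getVert_zero] at h₁
        exact .inl (h₁ ▸ ha)
      · exact .inr ⟨k - 1, by lia, by rw [Nat.sub_add_cancel hk₀, h₁]⟩
  · have he : s(C.getVert (i + 1), y) ∈ E := by simp [hE, hc, hy]
    have h := htop he
    have h₁ := hle s(C.getVert (i + 1), y)
    rcases Sym2.eq_iff.1 (hedge s(C.getVert (i + 1), y)) with ⟨-, h₂⟩ | ⟨h₂, h₃⟩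
    · rw [← h₂] at h
      exact .inl h
    · rw [← h₂, ← h₃] at h₁
      have h₄ : idx (C.getVert (i + 1)) = i + 1 :=
        hinj' (hidx _).1 (hidx _).2 (by lia) (by lia) (hvert _)
      have := (hidx y).1
      exact .inr ⟨idx y - 1, by lia, by rw [Nat.sub_add_cancel this, hvert]⟩

/-- Theorem: If `G` is Hamiltonian on `n ≥ 4` vertices with a Hamiltonian
cycle `C` having exactly `t ≥ 1` chords (edges of `G` not on `C`), then
`Z(G) = F_1(G) ≤ t + 1`. -/
theorem zeroForcingNumber_le_chords_add_one {V : Type*} [Fintype V] [DecidableEq V]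
    (G : SimpleGraph V) [DecidableRel G.Adj] (hn : 4 ≤ Fintype.card V)
    (v : V) (C : G.Walk v v) (hC : C.IsHamiltonianCycle)
    (t : ℕ) (ht : (G.edgeFinset \ C.edges.toFinset).card = t) (ht1 : 1 ≤ t) :
    kForcingNumber G 1 ≤ t + 1 := by
  subst ht
  obtain ⟨e, he⟩ := Finset.card_pos.1 ht1
  induction e with
  | _ a b =>
    have hrot : (C.rotate a (hC.mem_support a)).edges.toFinset = C.edges.toFinset :=
      List.toFinset_eq_of_perm _ _ (C.rotate_edges a _).perm
    rw [← hrot] at he ⊢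
    exact kForcingNumber_one_le_of_chord_at_base (hC.rotate _) he
end

section
/- Let k and r ≥ 3 be positive integers and let G be a K_{1,r}-free finite simple graph with minimum degree δ ≥ 1. If I is a maximum k-independent set of G, then every vertex in V - I has at most k·(r - 1) neighbors in I. -/
open Finset SimpleGraph

/-- `S` is a `k`-independent set: the subgraph induced by `S` has maximum degree
less than `k`. -/
def KIndep {V : Type*} [Fintype V] [DecidableEq V] (G : SimpleGraph V)
    [DecidableRel G.Adj] (k : ℕ) (S : Finset V) : Prop :=
  ∀ v ∈ S, ((G.neighborFinset v) ∩ S).card < k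

/-- The `k`-independence number: the maximum cardinality of a `k`-independent set. -/
noncomputable def kIndepNumber {V : Type*} [Fintype V] [DecidableEq V] (G : SimpleGraph V)
    [DecidableRel G.Adj] (k : ℕ) : ℕ :=
  sSup {m | ∃ S : Finset V, KIndep G k S ∧ S.card = m}

/-- `G` is `K_{1,r}`-free: it has no induced subgraph isomorphic to the star `K_{1,r}`
(graph embeddings preserve both adjacency and non-adjacency, so they give induced
subgraphs). -/
def K1rFree {V : Type*} (G : SimpleGraph V) (r : ℕ) : Prop :=
  IsEmpty (completeBipartiteGraph (Fin 1) (Fin r) ↪g G)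

/-- A `k`-independent set with more than `k * n` vertices contains `n + 1` pairwise nonadjacent
vertices. -/
theorem KIndep.exists_isIndepSet {V : Type*} [Fintype V] [DecidableEq V] {G : SimpleGraph V}
    [DecidableRel G.Adj] {k : ℕ} (n : ℕ) {S : Finset V} (hS : KIndep G k S)
    (hn : k * n < S.card) : ∃ T ⊆ S, G.IsIndepSet T ∧ T.card = n + 1 := by
  induction n generalizing S with
  | zero =>
    obtain ⟨v, hv⟩ := Finset.card_pos.mp (by omega : 0 < S.card)
    exact ⟨{v}, by simpa using hv, by simp [SimpleGraph.IsIndepSet], by simp⟩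
  | succ n ih =>
    obtain ⟨v, hv⟩ := Finset.card_pos.mp (by omega : 0 < S.card)
    set N := insert v (G.neighborFinset v ∩ S)
    have hNS : N ⊆ S := Finset.insert_subset hv Finset.inter_subset_right
    have hNcard : N.card ≤ k := (Finset.card_insert_le _ _).trans (hS v hv)
    have hdiff : KIndep G k (S \ N) := fun w hw =>
      (Finset.card_le_card (Finset.inter_subset_inter_left Finset.sdiff_subset)).trans_lt
        (hS w (Finset.mem_sdiff.mp hw).1)
    have hcard : k * n < (S \ N).card := by
      rw [Finset.card_sdiff_of_subset hNS]
      rw [Nat.mul_succ] at hn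
      omega
    obtain ⟨T, hTS, hT, hTcard⟩ := ih hdiff hcard
    have hvT : v ∉ T := fun h => (Finset.mem_sdiff.mp (hTS h)).2 (Finset.mem_insert_self _ _)
    have hadj : ∀ w ∈ T, ¬ G.Adj v w := fun w hw h => by
      obtain ⟨hwS, hwN⟩ := Finset.mem_sdiff.mp (hTS hw)
      exact hwN (Finset.mem_insert_of_mem (Finset.mem_inter.mpr ⟨by simpa using h, hwS⟩))
    refine ⟨insert v T, Finset.insert_subset hv (hTS.trans Finset.sdiff_subset), ?_, ?_⟩
    · rw [Finset.coe_insert, SimpleGraph.IsIndepSet, Set.pairwise_insert]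
      exact ⟨hT, fun w hw _ => ⟨hadj w hw, fun h => hadj w hw h.symm⟩⟩
    · rw [Finset.card_insert_of_notMem hvT, hTcard]

/-- In a `K_{1,r}`-free graph no vertex has `r` pairwise nonadjacent neighbors. -/
theorem K1rFree.card_ne {V : Type*} {G : SimpleGraph V} {r : ℕ} (hfree : K1rFree G r) {v : V}
    {T : Finset V} (hvT : ∀ w ∈ T, G.Adj v w) (hT : G.IsIndepSet T) : T.card ≠ r := by
  rintro rfl
  let e := T.equivFin.symm
  refine hfree.false ⟨⟨Sum.elim (fun _ => v) (fun i => (e i : V)), ?_⟩, ?_⟩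
  · rintro (a | a) (b | b) h
    · rw [Subsingleton.elim a b]
    · exact absurd h (hvT _ (e b).2).ne
    · exact absurd h.symm (hvT _ (e a).2).ne
    · exact congrArg _ (e.injective (Subtype.ext h))
  · rintro (a | a) (b | b)
    · exact iff_of_false G.irrefl (by simp)
    · exact iff_of_true (hvT _ (e b).2) (by simp)
    · exact iff_of_true (hvT _ (e a).2).symm (by simp)
    · exact iff_of_false (fun h => hT (e a).2 (e b).2 h.ne h) (by simp)

/-- Proposition: Let `k ≥ 1`, `r ≥ 3`, and `G` a `K_{1,r}`-free graph with
minimum degree `δ ≥ 1`. If `I` is a maximum `k`-independent set, then every vertex in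
`V - I` has at most `k (r - 1)` neighbors in `I`. -/
theorem max_kIndep_neighbors_le {V : Type*} [Fintype V] [DecidableEq V]
    (G : SimpleGraph V) [DecidableRel G.Adj]
    (k r : ℕ) (hk : 1 ≤ k) (hr : 3 ≤ r) (hδ : 1 ≤ G.minDegree) (hfree : K1rFree G r)
    (I : Finset V) (hI : KIndep G k I) (hImax : I.card = kIndepNumber G k) :
    ∀ v : V, v ∉ I → ((G.neighborFinset v) ∩ I).card ≤ k * (r - 1) := by
  intro v _
  by_contra! hlt
  have hA : KIndep G k (G.neighborFinset v ∩ I) := fun w hw =>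
    (Finset.card_le_card (Finset.inter_subset_inter_left Finset.inter_subset_right)).trans_lt
      (hI w (Finset.mem_inter.mp hw).2)
  obtain ⟨T, hTA, hT, hTcard⟩ := hA.exists_isIndepSet (r - 1) hlt
  refine hfree.card_ne (v := v) (fun w hw => ?_) hT (by omega)
  simpa using (Finset.mem_inter.mp (hTA hw)).1
end
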